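/- If G is an α_i-metric graph, then G is (i + ⌈(i+1)/2⌉)-hyperbolic; that is, for every four vertices u,v,w,x of G, the difference between the largest and the second largest of the three sums d(u,v)+d(w,x), d(u,w)+d(v,x), d(u,x)+d(v,w) is at most 2i + 2⌈(i+1)/2⌉. -/

import Mathlib

/-- A graph `G` is `α_i`-metric if for all vertices `u, v, w, x` with `v ∈ I(u,w)`,
`w ∈ I(v,x)` and `v` adjacent to `w`, one has `d(u,x) ≥ d(u,v) + d(v,x) - i`. -/
def alphaMetric {V : Type*} (G : SimpleGraph V) (i : ℕ) : Prop :=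
  ∀ u v w x : V,
    G.dist u v + G.dist v w = G.dist u w →
    G.dist v w + G.dist w x = G.dist v x →
    G.Adj v w →
    G.dist u v + G.dist v x ≤ G.dist u x + i

/-- `G` is `δ`-hyperbolic with `c = 2δ`: for every four vertices, the difference
between the largest and the second largest of the three distance sums
`d(u,v)+d(w,x)`, `d(u,w)+d(v,x)`, `d(u,x)+d(v,w)` is at most `c`. Equivalently,
each of the three sums is at most the maximum of the other two plus `c`. -/
def hyperbolic {V : Type*} (G : SimpleGraph V) (c : ℕ) : Prop :=
  ∀ u v w x : V,
    G.dist u v + G.dist w x ≤ max (G.dist u w + G.dist v x) (G.dist u x + G.dist v w) + c ∧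
    G.dist u w + G.dist v x ≤ max (G.dist u v + G.dist w x) (G.dist u x + G.dist v w) + c ∧
    G.dist u x + G.dist v w ≤ max (G.dist u v + G.dist w x) (G.dist u w + G.dist v x) + c

theorem SimpleGraph.Connected.exists_adj_dist_add_one {V : Type*} {G : SimpleGraph V}
    (hconn : G.Connected) {x v : V} (h : x ≠ v) :
    ∃ p, G.Adj x p ∧ G.dist p v + 1 = G.dist x v := by
  obtain ⟨W, hW⟩ := hconn.exists_walk_length_eq_dist x v
  cases W with
  | nil => exact absurd rfl h
  | @cons _ p _ hp W' =>
    refine ⟨p, hp, ?_⟩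
    have h1 := SimpleGraph.dist_le W'
    have h2 := hconn.dist_triangle (u := x) (v := p) (w := v)
    have h3 := SimpleGraph.dist_eq_one_iff_adj.2 hp
    simp only [SimpleGraph.Walk.length_cons] at hW
    omega

/-- Slices of intervals in an `α_i`-metric graph have diameter at most `i + 1`. -/
theorem alphaMetric.dist_le_of_mem_slice {V : Type*} {G : SimpleGraph V} (hconn : G.Connected)
    {i : ℕ} (halpha : alphaMetric G i) {u v x y : V}
    (hx : G.dist u x + G.dist x v = G.dist u v) (hy : G.dist u y + G.dist y v = G.dist u v)
    (hxy : G.dist x v = G.dist y v) : G.dist x y ≤ i + 1 := by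
  induction hm : G.dist x v generalizing x y with
  | zero =>
    have hxv := hconn.dist_eq_zero_iff.1 hm
    have hyv := hconn.dist_eq_zero_iff.1 (hxy.symm.trans hm)
    simp [hxv, hyv]
  | succ m ih =>
    by_contra! hlt
    have hxv : x ≠ v := by rintro rfl; simp at hm
    have hyv : y ≠ v := by rintro rfl; rw [SimpleGraph.dist_self] at hxy; omega
    obtain ⟨p, hp, hpv⟩ := hconn.exists_adj_dist_add_one hxv
    obtain ⟨q, hq, hqv⟩ := hconn.exists_adj_dist_add_one hyv
    have hp1 := SimpleGraph.dist_eq_one_iff_adj.2 hp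
    have hq1 := SimpleGraph.dist_eq_one_iff_adj.2 hq
    have tp := hconn.dist_triangle (u := u) (v := p) (w := v)
    have tp' := hconn.dist_triangle (u := u) (v := x) (w := p)
    have tq := hconn.dist_triangle (u := u) (v := q) (w := v)
    have tq' := hconn.dist_triangle (u := u) (v := y) (w := q)
    have hpq := ih (x := p) (y := q) (by omega) (by omega) (by omega) (by omega)
    have t1 := hconn.dist_triangle (u := x) (v := p) (w := y)
    have t2 := hconn.dist_triangle (u := y) (v := x) (w := p)
    have t3 := hconn.dist_triangle (u := y) (v := q) (w := p)
    have c1 := G.dist_comm (u := x) (v := y)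
    have c2 := G.dist_comm (u := p) (v := y)
    have c3 := G.dist_comm (u := p) (v := q)
    have a1 := halpha y x p v
    have a2 := halpha u x p y
    have a3 := halpha u y q p
    have b1 : ¬ G.dist y x + G.dist x p = G.dist y p := fun h => by
      have := a1 h (by omega) hp
      omega
    have b2 : ¬ G.dist x p + G.dist p y = G.dist x y := fun h => by
      have := a2 (by omega) h hp
      omega
    have := a3 (by omega) (by omega) hq
    omega

theorem SimpleGraph.Connected.exists_mem_slice {V : Type*} {G : SimpleGraph V}
    (hconn : G.Connected) (u v : V) {k : ℕ} (hk : k ≤ G.dist u v) :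
    ∃ p, G.dist u p = k ∧ k + G.dist p v = G.dist u v := by
  induction k with
  | zero => exact ⟨u, by simp, by simp⟩
  | succ k ih =>
    obtain ⟨p, hp, hpv⟩ := ih (by omega)
    have hne : p ≠ v := by rintro rfl; omega
    obtain ⟨q, hq, hqv⟩ := hconn.exists_adj_dist_add_one hne
    have hq1 := SimpleGraph.dist_eq_one_iff_adj.2 hq
    have t1 := hconn.dist_triangle (u := u) (v := q) (w := v)
    have t2 := hconn.dist_triangle (u := u) (v := p) (w := q)
    exact ⟨q, by omega, by omega⟩

/-- A vertex of a slice closest to `x` almost lies on a geodesic from `x` to an endpoint of the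
interval. -/
theorem alphaMetric.exists_mem_slice_near_geodesic {V : Type*} {G : SimpleGraph V}
    (hconn : G.Connected) {i : ℕ} (halpha : alphaMetric G i) (u v x : V) {k : ℕ}
    (hk : k ≤ G.dist u v) :
    ∃ p, G.dist u p = k ∧ k + G.dist p v = G.dist u v ∧
      (G.dist x p + G.dist u v ≤ G.dist x v + k + i ∨ G.dist x p + k ≤ G.dist x u + i) := by
  have hne : {p | G.dist u p = k ∧ k + G.dist p v = G.dist u v}.Nonempty :=
    hconn.exists_mem_slice u v hk
  obtain ⟨p, ⟨hp1, hp2⟩, hmin⟩ := exists_minimalFor_of_wellFoundedLT _ (fun p => G.dist x p) hne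
  refine ⟨p, hp1, hp2, ?_⟩
  by_cases hpx : p = x
  · subst hpx
    simp only [SimpleGraph.dist_self]
    omega
  obtain ⟨q, hq, hqx⟩ := hconn.exists_adj_dist_add_one hpx
  have hq1 := SimpleGraph.dist_eq_one_iff_adj.2 hq
  have t1 := hconn.dist_triangle (u := u) (v := q) (w := v)
  have t2 := hconn.dist_triangle (u := u) (v := p) (w := q)
  have t3 := hconn.dist_triangle (u := q) (v := p) (w := v)
  have c1 := G.dist_comm (u := p) (v := q)
  have c2 := G.dist_comm (u := p) (v := x)
  have c3 := G.dist_comm (u := q) (v := x)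
  have c4 := G.dist_comm (u := u) (v := p)
  have c5 := G.dist_comm (u := u) (v := q)
  have hout : ¬ (G.dist u q = k ∧ k + G.dist q v = G.dist u v) := fun h => by
    have : G.dist x p ≤ G.dist x q := hmin h (by simp only; omega)
    omega
  have a1 := halpha x q p v
  have a2 := halpha x q p u
  by_cases h : G.dist u q = k + 1
  · have := a2 (by omega) (by omega) hq.symm
    omega
  · have := a1 (by omega) (by omega) hq.symm
    omega

/-- If one distance sum exceeds the two others by more than `3 * i + 1`, then the four remaining
distances are determined by three integer parameters. -/
theorem alphaMetric.dist_eq_of_lt {V : Type*} {G : SimpleGraph V}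
    (hconn : G.Connected) {i : ℕ} (halpha : alphaMetric G i) {u v w x : V}
    (h1 : G.dist u w + G.dist v x + 3 * i + 1 < G.dist u v + G.dist w x)
    (h2 : G.dist u x + G.dist v w + 3 * i + 1 < G.dist u v + G.dist w x) :
    ∃ a b k : ℕ, G.dist u w + i = a + k ∧ G.dist u x + i = b + k ∧
      G.dist v w + i + k + 1 = a + G.dist u v ∧ G.dist v x + i + k + 1 = b + G.dist u v ∧
      G.dist w x ≤ a + b + i + 1 := by
  have e1 := G.dist_comm (u := w) (v := u)
  have e2 := G.dist_comm (u := w) (v := v)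
  have e3 := G.dist_comm (u := x) (v := u)
  have e4 := G.dist_comm (u := x) (v := v)
  have : Nonempty V := ⟨u⟩
  choose! q hq1 hq2 hq using fun k => halpha.exists_mem_slice_near_geodesic hconn u v w (k := k)
  choose! p hp1 hp2 hp using fun k => halpha.exists_mem_slice_near_geodesic hconn u v x (k := k)
  have hwx : ∀ k ≤ G.dist u v, G.dist w x ≤ G.dist w (q k) + G.dist x (p k) + i + 1 := by
    intro k hk
    have e1 := hq1 k hk
    have e2 := hq2 k hk
    have e3 := hp1 k hk
    have e4 := hp2 k hk
    have := halpha.dist_le_of_mem_slice hconn (u := u) (v := v) (x := q k) (y := p k)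
      (by omega) (by omega) (by omega)
    have t1 := hconn.dist_triangle (u := w) (v := q k) (w := x)
    have t2 := hconn.dist_triangle (u := q k) (v := p k) (w := x)
    have c := G.dist_comm (u := x) (v := p k)
    omega
  have hex : ∃ k, ¬ (k ≤ G.dist u v → G.dist w (q k) + k ≤ G.dist w u + i) := by
    refine ⟨G.dist u v, fun h => ?_⟩
    have g1 := h le_rfl
    have g2 := hwx _ le_rfl
    have g3 := hp2 _ le_rfl
    have g4 : p (G.dist u v) = v := hconn.dist_eq_zero_iff.1 (by omega)
    rw [g4] at g2
    omega
  classical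
  obtain ⟨j, hj, hmin⟩ : ∃ j, ¬ (j ≤ G.dist u v → G.dist w (q j) + j ≤ G.dist w u + i) ∧
      ∀ m < j, m ≤ G.dist u v → G.dist w (q m) + m ≤ G.dist w u + i :=
    ⟨Nat.find hex, Nat.find_spec hex, fun m hm => not_not.1 (Nat.find_min hex hm)⟩
  cases j with
  | zero =>
    exfalso
    apply hj
    intro h
    have g : u = q 0 := hconn.dist_eq_zero_iff.1 (hq1 0 h)
    rw [← g]
    omega
  | succ k =>
    rw [Classical.not_imp] at hj
    obtain ⟨hj, hj'⟩ := hj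
    have hk := hmin k (by omega) (by omega)
    have f1 := hwx k (by omega)
    have f2 := hwx (k + 1) hj
    have f3 := hq k (by omega)
    have f4 := hq (k + 1) hj
    have f5 := hp k (by omega)
    have f6 := hp (k + 1) hj
    exact ⟨G.dist w (q k), G.dist x (p k), k, by omega, by omega, by omega, by omega, by omega⟩

theorem alphaMetric.dist_add_dist_le {V : Type*} {G : SimpleGraph V}
    (hconn : G.Connected) {i : ℕ} (halpha : alphaMetric G i) (u v w x : V) :
    G.dist u v + G.dist w x ≤ max (G.dist u w + G.dist v x) (G.dist u x + G.dist v w) +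
      (2 * i + 2 * ((i + 2) / 2)) := by
  by_contra! h
  have e1 := G.dist_comm (u := w) (v := u)
  have e2 := G.dist_comm (u := w) (v := v)
  have e3 := G.dist_comm (u := x) (v := u)
  have e4 := G.dist_comm (u := x) (v := v)
  obtain ⟨a, b, k, _, _, _, _, _⟩ := halpha.dist_eq_of_lt hconn (u := u) (v := v) (w := w) (x := x)
    (by omega) (by omega)
  obtain ⟨a', b', k', _, _, _, _, _⟩ := halpha.dist_eq_of_lt hconn
    (u := w) (v := x) (w := u) (x := v) (by omega) (by omega)
  omega

/-- Every `α_i`-metric graph is `(i + ⌈(i+1)/2⌉)`-hyperbolic: the largest minus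
the second largest distance sum is at most `2i + 2⌈(i+1)/2⌉`, where
`⌈(i+1)/2⌉ = (i+2)/2` (natural division). -/
theorem stmt9 {V : Type*} [Fintype V] (G : SimpleGraph V) (hconn : G.Connected)
    (i : ℕ) (halpha : alphaMetric G i) :
    hyperbolic G (2 * i + 2 * ((i + 2) / 2)) := by
  intro u v w x
  have h1 := halpha.dist_add_dist_le hconn u v w x
  have h2 := halpha.dist_add_dist_le hconn u w v x
  have h3 := halpha.dist_add_dist_le hconn u x v w
  rw [G.dist_comm (u := w) (v := v)] at h2
  rw [G.dist_comm (u := x) (v := w), G.dist_comm (u := x) (v := v)] at h3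
  exact ⟨h1, h2, h3⟩
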